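/- Let f : ℝ → ℝ be infinitely differentiable, let τ > 0 and C̃_f > 0, and let v(y;θ) = (1/√(2π))·exp(−(y − f(θ/τ))²/2). For fixed y ∈ ℝ set g(x) = (f(x/τ) − y)/2 and h_j(x) = f^{(j)}(x/τ)/(C̃_f^j·j!). Then for every integer n ≥ 0 and all x, y ∈ ℝ, |∂_θ^{n} v(y;θ)|_{θ=x}| ≤ e^{−g(x)²/2}·((2·C̃_f)^n/τ^n)·n!·e^n·max( (Σ_{j=1}^{n} |h_j(x)|)^n, 1 ). -/

import Mathlib

open MeasureTheory Real Filter

/-- The Gaussian source density `u(x;θ)` with standard deviation `σ`. -/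
noncomputable def srcDensity (σ θ x : ℝ) : ℝ :=
  (1 / (Real.sqrt (2 * Real.pi) * σ)) * Real.exp (-(x - θ)^2 / (2 * σ^2))

/-- The Gaussian link target density `v(y;θ) = (1/√(2π))·exp(−(y − f(θ/τ))²/2)`. -/
noncomputable def linkDensity (f : ℝ → ℝ) (τ y θ : ℝ) : ℝ :=
  (1 / Real.sqrt (2 * Real.pi)) * Real.exp (-(y - f (θ/τ))^2 / 2)

/-- The weighted derivative sum `Σ_{j=1}^{n} |f^{(j)}(t)|/(C̃^j·j!)`. -/
noncomputable def derivSumF (f : ℝ → ℝ) (Ct : ℝ) (n : ℕ) (t : ℝ) : ℝ :=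
  ∑ j ∈ Finset.Icc 1 n, |iteratedDeriv j f t| / (Ct^j * (Nat.factorial j : ℝ))

/-- Assumption 3 on the link function `f` with constants `(Cf, C̃f)`. -/
structure Assumption3 (f : ℝ → ℝ) (Cf : ℕ) (Ct : ℝ) : Prop where
  Ct_pos : 0 < Ct
  smooth : ContDiff ℝ (⊤ : ℕ∞) f
  bound_int : ∀ (θ : ℝ) (n : ℕ), 1 ≤ n → ∀ τ : ℝ, 2 * Real.sqrt 2 * max 1 |θ| ≤ τ →
    Integrable (fun x : ℝ =>
      (derivSumF f Ct n ((θ + Real.sqrt 2 * x)/τ))^n *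
        (Real.exp (-x^2/2) / Real.sqrt (2 * Real.pi)))
  bound_le : ∀ (θ : ℝ) (n : ℕ), 1 ≤ n → ∀ τ : ℝ, 2 * Real.sqrt 2 * max 1 |θ| ≤ τ →
    ∫ x : ℝ,
      (derivSumF f Ct n ((θ + Real.sqrt 2 * x)/τ))^n *
        (Real.exp (-x^2/2) / Real.sqrt (2 * Real.pi))
      ≤ (Nat.factorial (Cf * n) : ℝ)

/-- `C̄f = 32π²·(2e)^{4(1+Cf)}·e^{4(1+Cf)²}`. -/
noncomputable def CbarF (Cf : ℕ) : ℝ :=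
  32 * Real.pi^2 * (2 * Real.exp 1)^(4*(1+Cf)) * (Real.exp 1)^(4*(1+Cf)^2)

/-- `L_f(n) = sup_{|x|≤1} Σ_{j=1}^{n} |f^{(j)}(x)|/(C̃f^j·j!)`. -/
noncomputable def Lf (f : ℝ → ℝ) (Ct : ℝ) (n : ℕ) : ℝ :=
  ⨆ x ∈ {x : ℝ | |x| ≤ 1}, derivSumF f Ct n x

/-- `L̃_f(n,τ) = sup_{|x|≥1} (Σ_{j=1}^{n} |f^{(j)}(x)|/(C̃f^j·j!))·exp(−τ²x²/(8n))`. -/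
noncomputable def Ltf (f : ℝ → ℝ) (Ct : ℝ) (n : ℕ) (τ : ℝ) : ℝ :=
  ⨆ x ∈ {x : ℝ | 1 ≤ |x|},
    derivSumF f Ct n x * Real.exp (-(τ^2 * x^2) / (8*(n:ℝ)))

/-- The truncated signed kernel `S*_N(y|x)` (with `σ = 1`). -/
noncomputable def signedKernel (σ : ℝ) (v : ℝ → ℝ → ℝ) (N : ℕ) (y x : ℝ) : ℝ :=
  ∑ k ∈ Finset.range (N + 1),
    ((-1 : ℝ)^k * σ^(2*k) / ((2:ℝ)^k * (Nat.factorial k : ℝ))) *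
      iteratedDeriv (2*k) (fun θ => v y θ) x

/-- `p(x) = ∫ max(S*_N(y|x), 0) dy`. -/
noncomputable def pFun (σ : ℝ) (v : ℝ → ℝ → ℝ) (N : ℕ) (x : ℝ) : ℝ :=
  ∫ y : ℝ, max (signedKernel σ v N y x) 0

/-- `q(x) = −∫ min(S*_N(y|x), 0) dy`. -/
noncomputable def qFun (σ : ℝ) (v : ℝ → ℝ → ℝ) (N : ℕ) (x : ℝ) : ℝ :=
  - ∫ y : ℝ, min (signedKernel σ v N y x) 0

/-- The Markov kernel `T*_N(y|x) = max(S*_N(y|x), 0)/p(x)`. -/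
noncomputable def markovKernel (σ : ℝ) (v : ℝ → ℝ → ℝ) (N : ℕ) (y x : ℝ) : ℝ :=
  max (signedKernel σ v N y x) 0 / pFun σ v N x

/-- The iterated derivatives of `F` at `z` and of `f` at `x` agree up to order `n`. -/
def JetEq (n : ℕ) (F : ℂ → ℂ) (z : ℂ) (f : ℝ → ℝ) (x : ℝ) : Prop :=
  ∀ j ≤ n, iteratedDeriv j F z = ((iteratedDeriv j f x : ℝ) : ℂ)

namespace JetEq

variable {n : ℕ} {F G : ℂ → ℂ} {z : ℂ} {f g : ℝ → ℝ} {x : ℝ}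

theorem mono {m : ℕ} (h : JetEq n F z f x) (hm : m ≤ n) : JetEq m F z f x :=
  fun j hj => h j (hj.trans hm)

theorem deriv (h : JetEq (n + 1) F z f x) : JetEq n (deriv F) z (deriv f) x := by
  intro j hj
  rw [← iteratedDeriv_succ', ← iteratedDeriv_succ']
  exact h (j + 1) (by lia)

theorem mul (hF : ContDiff ℂ (⊤ : ℕ∞) F) (hG : ContDiff ℂ (⊤ : ℕ∞) G)
    (hf : ContDiff ℝ (⊤ : ℕ∞) f) (hg : ContDiff ℝ (⊤ : ℕ∞) g)
    (h₁ : JetEq n F z f x) (h₂ : JetEq n G z g x) :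
    JetEq n (fun z => F z * G z) z (fun x => f x * g x) x := by
  intro j hj
  have le : ((j : ℕ∞) : WithTop ℕ∞) ≤ ((⊤ : ℕ∞) : WithTop ℕ∞) := by exact_mod_cast le_top
  rw [iteratedDeriv_fun_mul (hF.of_le le).contDiffAt (hG.of_le le).contDiffAt,
    iteratedDeriv_fun_mul (hf.of_le le).contDiffAt (hg.of_le le).contDiffAt]
  push_cast
  refine Finset.sum_congr rfl fun i hi => ?_
  rw [Finset.mem_range] at hi
  rw [h₁ i (by lia), h₂ (j - i) (by lia)]

theorem const_mul (c : ℝ) (h : JetEq n F z f x) :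
    JetEq n (fun z => (c : ℂ) * F z) z (fun x => c * f x) x := by
  intro j hj
  rw [iteratedDeriv_const_mul_field, iteratedDeriv_const_mul_field, h j hj]
  push_cast
  rfl

theorem exp (hF : ContDiff ℂ (⊤ : ℕ∞) F) (hf : ContDiff ℝ (⊤ : ℕ∞) f)
    (h : JetEq n F z f x) :
    JetEq n (fun z => Complex.exp (F z)) z (fun x => Real.exp (f x)) x := by
  induction n with
  | zero =>
    intro j hj
    obtain rfl : j = 0 := by lia
    have := h 0 le_rfl
    simp only [iteratedDeriv_zero] at this ⊢
    rw [this, Complex.ofReal_exp]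
  | succ n ih =>
    have hF' : _root_.deriv (fun z => Complex.exp (F z)) =
        fun z => Complex.exp (F z) * _root_.deriv F z :=
      funext fun z => ((hF.differentiable (by simp)) z).hasDerivAt.cexp.deriv
    have hf' : _root_.deriv (fun x => Real.exp (f x)) =
        fun x => Real.exp (f x) * _root_.deriv f x :=
      funext fun x => ((hf.differentiable (by simp)) x).hasDerivAt.exp.deriv
    have ih := ih (h.mono n.le_succ)
    intro j hj
    cases j with
    | zero => exact ih 0 (Nat.zero_le _)
    | succ j =>
      rw [iteratedDeriv_succ', iteratedDeriv_succ', hF', hf']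
      exact mul hF.cexp (contDiff_infty_iff_deriv.1 hF).2 hf.exp
        (contDiff_infty_iff_deriv.1 hf).2 ih h.deriv j (by lia)

end JetEq

/-- The complexified Taylor polynomial of `u` at `t`. -/
noncomputable def complexTaylor (u : ℝ → ℝ) (t : ℝ) (n : ℕ) (z : ℂ) : ℂ :=
  ∑ j ∈ Finset.range (n + 1), ((iteratedDeriv j u t / (Nat.factorial j : ℝ) : ℝ) : ℂ) * z ^ j

theorem contDiff_complexTaylor (u : ℝ → ℝ) (t : ℝ) (n : ℕ) :
    ContDiff ℂ (⊤ : ℕ∞) (complexTaylor u t n) := by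
  unfold complexTaylor
  fun_prop

theorem jetEq_complexTaylor (u : ℝ → ℝ) (t : ℝ) (n : ℕ) :
    JetEq n (complexTaylor u t n) 0 u t := by
  intro j hj
  unfold complexTaylor
  rw [iteratedDeriv_fun_sum (fun i _ => by fun_prop)]
  simp only [iteratedDeriv_const_mul_field, iteratedDeriv_fun_pow_zero]
  rw [Finset.sum_eq_single j (fun i _ hi => by simp [hi.symm])
    (fun h => absurd (Finset.mem_range.2 (by lia)) h)]
  have : (Nat.factorial j : ℂ) ≠ 0 := by exact_mod_cast j.factorial_ne_zero
  simp only [if_true]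
  push_cast
  field_simp

theorem norm_complexTaylor_sub_le (u : ℝ → ℝ) (t : ℝ) (n : ℕ) (z : ℂ) :
    ‖complexTaylor u t n z - (u t : ℂ)‖ ≤
      ∑ j ∈ Finset.Icc 1 n, |iteratedDeriv j u t| / (Nat.factorial j : ℝ) * ‖z‖ ^ j := by
  have : complexTaylor u t n z - (u t : ℂ) =
      ∑ j ∈ Finset.Icc 1 n, ((iteratedDeriv j u t / (Nat.factorial j : ℝ) : ℝ) : ℂ) * z ^ j := by
    rw [complexTaylor, Finset.range_eq_Ico, Finset.sum_eq_sum_Ico_succ_bot (Nat.succ_pos n)]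
    simp [Finset.Ico_add_one_right_eq_Icc]
  rw [this]
  refine (norm_sum_le _ _).trans_eq (Finset.sum_congr rfl fun j _ => ?_)
  rw [norm_mul, norm_pow, Complex.norm_real, Real.norm_eq_abs, abs_div, Nat.abs_cast]

theorem norm_cexp_neg_sq_div_two_le (a : ℝ) (w : ℂ) (h : ‖w - (a : ℂ)‖ ≤ 1) :
    ‖Complex.exp ((-1 / 2 : ℝ) * (w * w))‖ ≤ Real.exp (-a ^ 2 / 4 + 1 / 2) := by
  rw [Complex.norm_exp, Real.exp_le_exp, Complex.re_ofReal_mul, Complex.mul_re]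
  have h₁ : ‖w - (a : ℂ)‖ ^ 2 ≤ 1 := pow_le_one₀ (norm_nonneg _) h
  rw [← Complex.normSq_eq_norm_sq, Complex.normSq_apply] at h₁
  simp only [Complex.sub_re, Complex.sub_im, Complex.ofReal_re, Complex.ofReal_im, sub_zero] at h₁
  nlinarith [sq_nonneg (2 * w.re - a)]

/-- Cauchy estimate for the derivatives of `exp (-u ^ 2 / 2)` in terms of the Taylor
coefficients of `u`. -/
theorem abs_iteratedDeriv_exp_neg_sq_le {u : ℝ → ℝ} (hu : ContDiff ℝ (⊤ : ℕ∞) u) (t : ℝ)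
    (n : ℕ) {r : ℝ} (hr : 0 < r)
    (h : ∑ j ∈ Finset.Icc 1 n, |iteratedDeriv j u t| / (Nat.factorial j : ℝ) * r ^ j ≤ 1) :
    |iteratedDeriv n (fun s => Real.exp (-u s ^ 2 / 2)) t| ≤
      (Nat.factorial n : ℝ) * Real.exp (-u t ^ 2 / 4 + 1 / 2) / r ^ n := by
  have hU := contDiff_complexTaylor u t n
  have hJ := jetEq_complexTaylor u t n
  have hE := ((JetEq.mul hU hU hu hu hJ hJ).const_mul (-1 / 2)).exp
    (contDiff_const.mul (hU.mul hU)) (contDiff_const.mul (hu.mul hu)) n le_rfl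
  have heq : (fun s => Real.exp (-u s ^ 2 / 2)) =
      fun s => Real.exp (-1 / 2 * (u s * u s)) := by
    funext s
    ring_nf
  rw [heq, ← Real.norm_eq_abs, ← Complex.norm_real, ← hE]
  refine Complex.norm_iteratedDeriv_le_of_forall_mem_sphere_norm_le n hr ?_ fun z hz => ?_
  · exact ((contDiff_const.mul (hU.mul hU)).cexp.differentiable (by simp)).diffContOnCl
  · refine norm_cexp_neg_sq_div_two_le _ _ ((norm_complexTaylor_sub_le u t n z).trans ?_)
    rwa [mem_sphere_zero_iff_norm.1 hz]

theorem derivSumF_nonneg (f : ℝ → ℝ) {Ct : ℝ} (hCt : 0 < Ct) (n : ℕ) (t : ℝ) :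
    0 ≤ derivSumF f Ct n t :=
  Finset.sum_nonneg fun _ _ => by positivity

theorem sum_taylor_le_one (f : ℝ → ℝ) {Ct : ℝ} (hCt : 0 < Ct) (n : ℕ) (t : ℝ) :
    ∑ j ∈ Finset.Icc 1 n, |iteratedDeriv j f t| / (Nat.factorial j : ℝ) *
      (1 / (Ct * max (derivSumF f Ct n t) 1)) ^ j ≤ 1 := by
  set M := max (derivSumF f Ct n t) 1
  have hM : 1 ≤ M := le_max_right _ _
  have hM0 : 0 < M := by linarith
  calc
    _ ≤ ∑ j ∈ Finset.Icc 1 n, |iteratedDeriv j f t| / (Ct ^ j * (Nat.factorial j : ℝ)) / M := by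
      refine Finset.sum_le_sum fun j hj => ?_
      have hj1 : j ≠ 0 := by have := (Finset.mem_Icc.1 hj).1; lia
      calc
        _ = |iteratedDeriv j f t| / (Ct ^ j * (Nat.factorial j : ℝ)) / M ^ j := by
          have : (Nat.factorial j : ℝ) ≠ 0 := by positivity
          rw [one_div_pow, mul_pow]
          field_simp
        _ ≤ _ := by
          gcongr
          exact le_self_pow₀ hM hj1
    _ = derivSumF f Ct n t / M := by rw [derivSumF, Finset.sum_div]
    _ ≤ 1 := (div_le_one hM0).2 (le_max_left _ _)

theorem inv_sqrt_two_pi_mul_exp_half_le_one :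
    1 / Real.sqrt (2 * Real.pi) * Real.exp (1 / 2) ≤ 1 := by
  rw [div_mul_eq_mul_div, one_mul, div_le_one (by positivity)]
  refine Real.le_sqrt_of_sq_le ?_
  rw [← Real.exp_nat_mul]
  norm_num
  linarith [Real.exp_one_lt_d9, Real.pi_gt_three]

/-- pointwise bound on the derivatives of the Gaussian link
target density `v(y;θ)` in the parameter. -/
theorem link_derivative_bound
    (f : ℝ → ℝ) (hf : ContDiff ℝ (⊤ : ℕ∞) f)
    (τ Ct : ℝ) (hτ : 0 < τ) (hCt : 0 < Ct) :
    ∀ (n : ℕ) (x y : ℝ),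
      |iteratedDeriv n (fun θ => linkDensity f τ y θ) x|
        ≤ Real.exp (-((f (x/τ) - y)/2)^2 / 2) * ((2*Ct)^n / τ^n) *
            (Nat.factorial n : ℝ) * (Real.exp 1)^n *
            max ((derivSumF f Ct n (x/τ))^n) 1 := by
  intro n x y
  set t := x / τ with ht
  set M := max (derivSumF f Ct n t) 1 with hM
  have hM1 : 1 ≤ M := le_max_right _ _
  have hMn : M ^ n ≤ max (derivSumF f Ct n t ^ n) 1 := by
    rcases max_cases (derivSumF f Ct n t) 1 with h | h
    · rw [hM, h.1]
      exact le_max_left _ _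
    · rw [hM, h.1, one_pow]
      exact le_max_right _ _
  have hu : ContDiff ℝ (⊤ : ℕ∞) (fun s => y - f s) := contDiff_const.sub hf
  have hle : ((n : ℕ∞) : WithTop ℕ∞) ≤ ((⊤ : ℕ∞) : WithTop ℕ∞) := by exact_mod_cast le_top
  have hG : ContDiff ℝ n (fun s => Real.exp (-(y - f s) ^ 2 / 2)) :=
    (((hu.pow 2).neg.div_const 2).exp).of_le hle
  have hr : 0 < 1 / (Ct * M) := by positivity
  have hbound := abs_iteratedDeriv_exp_neg_sq_le hu t n hr (by
    refine le_of_eq_of_le (Finset.sum_congr rfl fun j hj => ?_) (sum_taylor_le_one f hCt n t)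
    rw [iteratedDeriv_const_sub (Finset.mem_Icc.1 hj).1, iteratedDeriv_neg, abs_neg])
  have hscale : iteratedDeriv n (fun θ => linkDensity f τ y θ) x =
      1 / Real.sqrt (2 * Real.pi) * ((τ⁻¹) ^ n *
        iteratedDeriv n (fun s => Real.exp (-(y - f s) ^ 2 / 2)) t) := by
    have hcomp := congrFun (iteratedDeriv_comp_const_mul hG τ⁻¹) x
    simp only [linkDensity, ht, div_eq_inv_mul _ τ]
    rw [iteratedDeriv_const_mul_field, hcomp]
  have hexp : Real.exp (-(y - f t) ^ 2 / 4) ≤ Real.exp (-((f t - y) / 2) ^ 2 / 2) := by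
    rw [Real.exp_le_exp]
    nlinarith [sq_nonneg (y - f t)]
  have he : 1 ≤ (2 : ℝ) ^ n * Real.exp 1 ^ n :=
    one_le_mul_of_one_le_of_one_le (one_le_pow₀ one_le_two)
      (one_le_pow₀ (Real.one_le_exp zero_le_one))
  rw [hscale, abs_mul, abs_mul, abs_of_pos (by positivity : 0 < 1 / Real.sqrt (2 * Real.pi)),
    abs_of_pos (by positivity : 0 < τ⁻¹ ^ n)]
  calc
    _ ≤ 1 / Real.sqrt (2 * Real.pi) * (τ⁻¹ ^ n * ((Nat.factorial n : ℝ) *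
          Real.exp (-(y - f t) ^ 2 / 4 + 1 / 2) / (1 / (Ct * M)) ^ n)) := by gcongr
    _ = (1 / Real.sqrt (2 * Real.pi) * Real.exp (1 / 2)) * 1 *
          (Real.exp (-(y - f t) ^ 2 / 4) * (Ct ^ n / τ ^ n) * (Nat.factorial n : ℝ) * M ^ n) := by
      rw [Real.exp_add, one_div_pow, mul_pow, inv_pow]
      field_simp
    _ ≤ 1 * ((2 : ℝ) ^ n * Real.exp 1 ^ n) *
          (Real.exp (-((f t - y) / 2) ^ 2 / 2) * (Ct ^ n / τ ^ n) * (Nat.factorial n : ℝ) *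
            max (derivSumF f Ct n t ^ n) 1) := by
      gcongr
      exact inv_sqrt_two_pi_mul_exp_half_le_one
    _ = _ := by
      rw [mul_pow]
      ring
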